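/- For every positive integer n: Φ*_n(−1) = −2 if n = 1; Φ*_n(−1) = 0 if n = 2^a with a ≥ 1; Φ*_n(−1) = p^b if n = 2^a p^b with p an odd prime and a, b ≥ 1; and Φ*_n(−1) = 1 in all other cases. -/

import Mathlib

open Polynomial Finset

/-- The finset of unitary divisors of `n`: divisors `d` of `n` with `gcd (d, n / d) = 1`. -/
def unitaryDivisors (n : ℕ) : Finset ℕ :=
  n.divisors.filter fun d => Nat.Coprime d (n / d)

/-- `d ∣∣ n`: `d` is a unitary divisor of `n`. -/
def IsUnitaryDivisor (d n : ℕ) : Prop := d ∈ unitaryDivisors n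

/-- `(j, n)_*`: the greatest `d` such that `d ∣ j` and `d` is a unitary divisor of `n`. -/
def unitaryGcd (j n : ℕ) : ℕ :=
  ((unitaryDivisors n).filter fun d => d ∣ j).sup id

/-- `κ(n)`: the squarefree kernel (radical) of `n`. -/
def kernel (n : ℕ) : ℕ := ∏ p ∈ n.primeFactors, p

/-- `φ*(n)`: the unitary Euler totient function. -/
def unitaryTotient (n : ℕ) : ℕ :=
  ((Finset.Icc 1 n).filter fun j => unitaryGcd j n = 1).card

/-- `μ*(n) = (-1)^{ω(n)}`: the unitary Moebius function. -/
def unitaryMoebius (n : ℕ) : ℤ := (-1) ^ n.primeFactors.card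

/-- `Φ*_n`: the unitary cyclotomic polynomial (over `ℂ`). -/
noncomputable def unitaryCyclotomic (n : ℕ) : Polynomial ℂ :=
  ∏ j ∈ (Finset.Icc 1 n).filter fun j => unitaryGcd j n = 1,
    (X - C (Complex.exp (2 * (Real.pi : ℂ) * Complex.I * (j : ℂ) / (n : ℂ))))

/-- `c*_n(k)`: the unitary Ramanujan sum. -/
noncomputable def unitaryRamanujan (n k : ℕ) : ℂ :=
  ∑ j ∈ (Finset.Icc 1 n).filter fun j => unitaryGcd j n = 1,
    Complex.exp (2 * (Real.pi : ℂ) * Complex.I * (j : ℂ) * (k : ℂ) / (n : ℂ))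

/-- `c_n(k)`: the classical Ramanujan sum. -/
noncomputable def ramanujanSum (n k : ℕ) : ℂ :=
  ∑ j ∈ (Finset.Icc 1 n).filter fun j => Nat.Coprime j n,
    Complex.exp (2 * (Real.pi : ℂ) * Complex.I * (j : ℂ) * (k : ℂ) / (n : ℂ))

/-- The unitary convolution `(f × g)(n) = ∑_{d ∣∣ n} f(d) g(n/d)`. -/
noncomputable def unitaryConv (f g : ℕ → ℂ) (n : ℕ) : ℂ :=
  ∑ d ∈ unitaryDivisors n, f d * g (n / d)

/-- `Λ*(n)`: the unitary von Mangoldt function, `a log p` for `n = p^a`, else `0`. -/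
noncomputable def unitaryVonMangoldt (n : ℕ) : ℝ :=
  if IsPrimePow n then (n.factorization n.minFac : ℝ) * Real.log n.minFac else 0

theorem mem_unitaryDivisors {d n : ℕ} :
    d ∈ unitaryDivisors n ↔ (d ∣ n ∧ n ≠ 0) ∧ Nat.Coprime d (n / d) := by
  simp [unitaryDivisors]

theorem unitaryGcd_eq_one_iff {j n : ℕ} (hn : 0 < n) :
    unitaryGcd j n = 1 ↔ ∀ d ∈ unitaryDivisors n, d ∣ j → d = 1 := by
  have h1 : 1 ∈ (unitaryDivisors n).filter fun d => d ∣ j := by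
    simp [mem_unitaryDivisors, hn.ne']
  have hle : 1 ≤ unitaryGcd j n := Finset.le_sup (f := id) h1
  constructor
  · intro h d hd hdj
    have hd1 : d ≤ unitaryGcd j n :=
      Finset.le_sup (f := id) (Finset.mem_filter.2 ⟨hd, hdj⟩)
    have := Nat.pos_of_dvd_of_pos (mem_unitaryDivisors.1 hd).1.1 hn
    omega
  · intro h
    refine le_antisymm (Finset.sup_le fun d hd => ?_) hle
    rw [Finset.mem_filter] at hd
    exact (h d hd.1 hd.2).le

theorem unitaryGcd_add_mul_eq_one_iff {m : ℕ} (hm : 0 < m) (j i : ℕ) :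
    unitaryGcd (j + m * i) m = 1 ↔ unitaryGcd j m = 1 := by
  rw [unitaryGcd_eq_one_iff hm, unitaryGcd_eq_one_iff hm]
  refine forall₂_congr fun d hd => ?_
  rw [Nat.dvd_add_left ((mem_unitaryDivisors.1 hd).1.1.mul_right i)]

theorem unitaryGcd_mul_eq_one_iff {m q : ℕ} (hm : 0 < m) (h : m.Coprime q) (k : ℕ) :
    unitaryGcd (q * k) m = 1 ↔ unitaryGcd k m = 1 := by
  rw [unitaryGcd_eq_one_iff hm, unitaryGcd_eq_one_iff hm]
  refine forall₂_congr fun d hd => ?_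
  rw [(h.coprime_dvd_left (mem_unitaryDivisors.1 hd).1.1).dvd_mul_left]

theorem unitaryGcd_mul_prime_pow_eq_one_iff {m p b : ℕ} (hm : 0 < m) (hp : p.Prime) (hb : b ≠ 0)
    (h : m.Coprime (p ^ b)) (j : ℕ) :
    unitaryGcd j (m * p ^ b) = 1 ↔ unitaryGcd j m = 1 ∧ ¬ p ^ b ∣ j := by
  have hq : 0 < p ^ b := Nat.pow_pos hp.pos
  rw [unitaryGcd_eq_one_iff hm, unitaryGcd_eq_one_iff (Nat.mul_pos hm hq)]
  constructor
  · refine fun H => ⟨fun d hd => H d ?_, fun hj => ?_⟩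
    · obtain ⟨⟨hdm, -⟩, hc⟩ := mem_unitaryDivisors.1 hd
      refine mem_unitaryDivisors.2 ⟨⟨hdm.mul_right _, (Nat.mul_pos hm hq).ne'⟩, ?_⟩
      rw [Nat.mul_div_right_comm hdm]
      exact hc.mul_right (h.coprime_dvd_left hdm)
    · refine (Nat.one_lt_pow hb hp.one_lt).ne' (H _ (mem_unitaryDivisors.2 ⟨⟨dvd_mul_left _ _,
        (Nat.mul_pos hm hq).ne'⟩, ?_⟩) hj)
      rw [Nat.mul_div_cancel _ hq]
      exact h.symm
  · rintro ⟨H, hj⟩ d hd hdj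
    obtain ⟨⟨⟨e, he⟩, -⟩, hc⟩ := mem_unitaryDivisors.1 hd
    have hd0 : 0 < d := Nat.pos_of_ne_zero fun h0 => by
      simp [h0, hm.ne', hp.ne_zero] at he
    rw [he, Nat.mul_div_cancel_left _ hd0] at hc
    by_cases hpd : p ∣ d
    · have hpe : (p ^ b).Coprime e := (hc.coprime_dvd_left hpd).pow_left b
      exact absurd ((hpe.dvd_of_dvd_mul_right (he ▸ dvd_mul_left _ _)).trans hdj) hj
    · have hdq : d.Coprime (p ^ b) := (((Nat.Prime.coprime_iff_not_dvd hp).2 hpd).pow_left b).symm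
      have hdm : d ∣ m := hdq.dvd_of_dvd_mul_right ⟨e, he⟩
      refine H d (mem_unitaryDivisors.2 ⟨⟨hdm, hm.ne'⟩, hc.coprime_dvd_right ?_⟩) hdj
      obtain ⟨c, rfl⟩ := hdm
      rw [Nat.mul_div_cancel_left _ hd0]
      exact ⟨p ^ b, Nat.eq_of_mul_eq_mul_left hd0 (by rw [← he, mul_assoc])⟩

theorem eval_unitaryCyclotomic (n : ℕ) (x : ℂ) :
    eval x (unitaryCyclotomic n) = ∏ j ∈ (Icc 1 n).filter fun j => unitaryGcd j n = 1,
      (x - Complex.exp (2 * (Real.pi : ℂ) * Complex.I * (j : ℂ) / (n : ℂ))) := by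
  simp [unitaryCyclotomic, eval_prod]

theorem prod_sub_exp_add_mul {m q : ℕ} (hm : 0 < m) (hq : 0 < q) (k : ℕ) (x : ℂ) :
    ∏ i ∈ range q, (x - Complex.exp (2 * (Real.pi : ℂ) * Complex.I * ((k + m * i : ℕ) : ℂ) /
      ((m * q : ℕ) : ℂ))) =
      x ^ q - Complex.exp (2 * (Real.pi : ℂ) * Complex.I * (k : ℂ) / (m : ℂ)) := by
  have hm' : (m : ℂ) ≠ 0 := by exact_mod_cast hm.ne'
  have hq' : (q : ℂ) ≠ 0 := by exact_mod_cast hq.ne'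
  have e : Complex.exp (2 * (Real.pi : ℂ) * Complex.I * (k : ℂ) / ((m * q : ℕ) : ℂ)) ^ q =
      Complex.exp (2 * (Real.pi : ℂ) * Complex.I * (k : ℂ) / (m : ℂ)) := by
    rw [← Complex.exp_nat_mul]
    congr 1
    push_cast
    field_simp
  have := congrArg (eval x) (X_pow_sub_C_eq_prod (Complex.isPrimitiveRoot_exp q hq.ne') hq e)
  simp only [eval_sub, eval_pow, eval_X, eval_C, eval_prod] at this
  rw [this]
  refine prod_congr rfl fun i _ => ?_
  rw [← Complex.exp_nat_mul, ← Complex.exp_add]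
  congr 2
  push_cast
  field_simp
  ring

theorem prod_filter_Icc_mul {M : Type*} [CommMonoid M] {m : ℕ} (hm : 0 < m) (q : ℕ)
    (P : ℕ → Prop) [DecidablePred P] (hP : ∀ j i, P (j + m * i) ↔ P j) (f : ℕ → M) :
    ∏ j ∈ (Icc 1 (m * q)).filter P, f j =
      ∏ k ∈ (Icc 1 m).filter P, ∏ i ∈ range q, f (k + m * i) := by
  rw [← prod_product']
  symm
  have key (j : ℕ) (hj : 1 ≤ j) : (j - 1) % m + 1 + m * ((j - 1) / m) = j := by
    have := Nat.mod_add_div (j - 1) m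
    omega
  refine prod_nbij' (fun a => a.1 + m * a.2) (fun j => ((j - 1) % m + 1, (j - 1) / m))
    ?_ ?_ ?_ ?_ fun _ _ => rfl
  · rintro ⟨k, i⟩ h
    simp only [mem_product, mem_filter, mem_Icc, mem_range] at h ⊢
    obtain ⟨⟨⟨h1, h2⟩, h3⟩, h4⟩ := h
    refine ⟨⟨by omega, ?_⟩, (hP _ _).2 h3⟩
    have := Nat.mul_le_mul_left m (Nat.succ_le_of_lt h4)
    rw [Nat.mul_succ] at this
    omega
  · intro j h
    simp only [mem_product, mem_filter, mem_Icc, mem_range] at h ⊢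
    obtain ⟨⟨h1, h2⟩, h3⟩ := h
    refine ⟨⟨⟨by omega, Nat.succ_le_of_lt (Nat.mod_lt _ hm)⟩, ?_⟩, ?_⟩
    · rw [← key j h1] at h3
      exact (hP _ _).1 h3
    · exact Nat.div_lt_of_lt_mul (by omega)
  · rintro ⟨k, i⟩ h
    simp only [mem_product, mem_filter, mem_Icc, mem_range] at h
    obtain ⟨⟨⟨h1, h2⟩, -⟩, -⟩ := h
    have hk : k + m * i - 1 = k - 1 + m * i := by omega
    have hlt : k - 1 < m := by omega
    simp only [hk, Nat.add_mul_mod_self_left, Nat.mod_eq_of_lt hlt,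
      Nat.add_mul_div_left _ _ hm, Nat.div_eq_of_lt hlt]
    ext <;> simp
    omega
  · intro j h
    simp only [mem_filter, mem_Icc] at h
    exact key j h.1.1

theorem eval_unitaryCyclotomic_mul_prime_pow {m p b : ℕ} (hm : 0 < m) (hp : p.Prime) (hb : b ≠ 0)
    (h : m.Coprime (p ^ b)) (x : ℂ) :
    eval x (unitaryCyclotomic (m * p ^ b)) * eval x (unitaryCyclotomic m) =
      eval (x ^ p ^ b) (unitaryCyclotomic m) := by
  have hq : 0 < p ^ b := Nat.pow_pos hp.pos
  have hq' : ((p ^ b : ℕ) : ℂ) ≠ 0 := by exact_mod_cast hq.ne'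
  simp only [eval_unitaryCyclotomic, ← prod_sub_exp_add_mul hm hq]
  rw [← prod_filter_Icc_mul hm (p ^ b) (fun j => unitaryGcd j m = 1)
      (fun j i => unitaryGcd_add_mul_eq_one_iff hm j i)
      (fun j => x - Complex.exp (2 * (Real.pi : ℂ) * Complex.I * (j : ℂ) / ((m * p ^ b : ℕ) : ℂ))),
    ← prod_filter_not_mul_prod_filter ((Icc 1 (m * p ^ b)).filter fun j => unitaryGcd j m = 1)
      (fun j => p ^ b ∣ j)]
  congr 1
  · rw [filter_filter]
    simp only [unitaryGcd_mul_prime_pow_eq_one_iff hm hp hb h]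
  · refine prod_nbij' (fun k => p ^ b * k) (fun j => j / p ^ b) ?_ ?_ ?_ ?_ ?_
    · intro k hk
      simp only [mem_filter, mem_Icc] at hk ⊢
      refine ⟨⟨⟨Nat.mul_pos hq hk.1.1, ?_⟩, (unitaryGcd_mul_eq_one_iff hm h k).2 hk.2⟩,
        dvd_mul_right _ _⟩
      rw [mul_comm]
      exact Nat.mul_le_mul_right _ hk.1.2
    · intro j hj
      simp only [mem_filter, mem_Icc] at hj ⊢
      obtain ⟨⟨⟨h1, h2⟩, h3⟩, k, rfl⟩ := hj
      rw [Nat.mul_div_cancel_left _ hq]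
      refine ⟨⟨Nat.pos_of_mul_pos_left h1, ?_⟩, (unitaryGcd_mul_eq_one_iff hm h k).1 h3⟩
      rw [mul_comm] at h2
      exact Nat.le_of_mul_le_mul_right h2 hq
    · intro k _
      exact Nat.mul_div_cancel_left _ hq
    · intro j hj
      exact Nat.mul_div_cancel' (mem_filter.1 hj).2
    · intro k _
      rw [Nat.cast_mul, Nat.cast_mul, mul_comm (m : ℂ), mul_left_comm, mul_div_mul_left _ _ hq']

theorem unitaryCyclotomic_one : unitaryCyclotomic 1 = X - 1 := by
  have : (Icc 1 1).filter (fun j => unitaryGcd j 1 = 1) = {1} := by decide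
  rw [unitaryCyclotomic, this]
  simp [Complex.exp_two_pi_mul_I]

theorem eval_unitaryCyclotomic_prime_pow_mul {p b : ℕ} (hp : p.Prime) (hb : b ≠ 0) (x : ℂ) :
    eval x (unitaryCyclotomic (p ^ b)) * (x - 1) = x ^ p ^ b - 1 := by
  simpa [unitaryCyclotomic_one] using
    eval_unitaryCyclotomic_mul_prime_pow one_pos hp hb (Nat.coprime_one_left _) x

theorem unitaryCyclotomic_prime_pow {p b : ℕ} (hp : p.Prime) (hb : b ≠ 0) :
    unitaryCyclotomic (p ^ b) = ∑ i ∈ range (p ^ b), X ^ i := by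
  have h1 : (X - 1 : ℂ[X]) ≠ 0 := X_sub_C_ne_zero 1
  refine mul_right_cancel₀ h1 ?_
  rw [geom_sum_mul]
  refine Polynomial.funext fun x => ?_
  simpa using eval_unitaryCyclotomic_prime_pow_mul hp hb x

theorem eval_neg_one_unitaryCyclotomic_two_pow {a : ℕ} (ha : a ≠ 0) :
    eval (-1) (unitaryCyclotomic (2 ^ a)) = 0 := by
  have h := eval_unitaryCyclotomic_prime_pow_mul Nat.prime_two ha (-1)
  rw [((even_two).pow_of_ne_zero ha).neg_one_pow, sub_self] at h
  exact (mul_eq_zero.1 h).resolve_right (by norm_num)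

theorem eval_neg_one_unitaryCyclotomic_mul_odd_prime_pow {m p b : ℕ} (hm : 0 < m) (hp : p.Prime)
    (hodd : Odd p) (hb : b ≠ 0) (h : m.Coprime (p ^ b))
    (h0 : eval (-1) (unitaryCyclotomic m) ≠ 0) :
    eval (-1) (unitaryCyclotomic (m * p ^ b)) = 1 := by
  have := eval_unitaryCyclotomic_mul_prime_pow hm hp hb h (-1)
  rw [hodd.pow.neg_one_pow] at this
  exact mul_right_cancel₀ h0 (by rw [this, one_mul])

theorem eval_neg_one_unitaryCyclotomic_two_pow_mul {p a b : ℕ} (hp : p.Prime) (hodd : Odd p)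
    (ha : a ≠ 0) (hb : b ≠ 0) :
    eval (-1) (unitaryCyclotomic (2 ^ a * p ^ b)) = (p : ℂ) ^ b := by
  have h := eval_unitaryCyclotomic_mul_prime_pow (Nat.pow_pos (n := b) hp.pos) Nat.prime_two ha
    (hodd.pow.coprime_two_right.pow_right a) (-1)
  have h1 := eval_neg_one_unitaryCyclotomic_mul_odd_prime_pow one_pos hp hodd hb
    (Nat.coprime_one_left _) (by norm_num [unitaryCyclotomic_one])
  rw [one_mul] at h1
  rw [h1, mul_one, ((even_two).pow_of_ne_zero ha).neg_one_pow, mul_comm,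
    unitaryCyclotomic_prime_pow hp hb] at h
  simpa [eval_finsetSum] using h

/-- values of `Φ*_n(-1)`. -/
theorem unitaryCyclotomic_eval_neg_one (n : ℕ) (hn : 0 < n) :
    (n = 1 → Polynomial.eval (-1) (unitaryCyclotomic n) = -2) ∧
    (∀ a : ℕ, 1 ≤ a → n = 2 ^ a → Polynomial.eval (-1) (unitaryCyclotomic n) = 0) ∧
    (∀ p a b : ℕ, p.Prime → Odd p → 1 ≤ a → 1 ≤ b → n = 2 ^ a * p ^ b →
      Polynomial.eval (-1) (unitaryCyclotomic n) = (p : ℂ) ^ b) ∧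
    (n ≠ 1 → (∀ a : ℕ, 1 ≤ a → n ≠ 2 ^ a) →
      (∀ p a b : ℕ, p.Prime → Odd p → 1 ≤ a → 1 ≤ b → n ≠ 2 ^ a * p ^ b) →
      Polynomial.eval (-1) (unitaryCyclotomic n) = 1) := by
  induction n using Nat.strong_induction_on with
  | _ n ih =>
  refine ⟨?_, ?_, ?_, ?_⟩
  · rintro rfl
    norm_num [unitaryCyclotomic_one]
  · rintro a ha rfl
    exact eval_neg_one_unitaryCyclotomic_two_pow (by omega)
  · rintro p a b hp hodd ha hb rfl
    exact eval_neg_one_unitaryCyclotomic_two_pow_mul hp hodd (by omega) (by omega)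
  · intro h1 h2 h3
    obtain ⟨p, hp, hpn, hp2⟩ : ∃ p, p.Prime ∧ p ∣ n ∧ p ≠ 2 := by
      by_contra! H
      have hpow := Nat.eq_prime_pow_of_unique_prime_dvd hn.ne' (fun {d} hd hdn => H d hd hdn)
      refine h2 _ (Nat.one_le_iff_ne_zero.2 fun h0 => h1 ?_) hpow
      rw [hpow, h0, pow_zero]
    have hodd := hp.odd_of_ne_two hp2
    obtain ⟨b, m, hpm, rfl⟩ := Nat.exists_eq_pow_mul_and_not_dvd hn.ne' p hp.ne_one
    have hb : b ≠ 0 := by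
      rintro rfl
      exact hpm (by simpa using hpn)
    have hm : 0 < m := Nat.pos_of_mul_pos_left hn
    have hlt : m < p ^ b * m := lt_mul_left hm (Nat.one_lt_pow hb hp.one_lt)
    have hcop : m.Coprime (p ^ b) := (((Nat.Prime.coprime_iff_not_dvd hp).2 hpm).pow_left b).symm
    rw [mul_comm (p ^ b)] at h3 ⊢
    refine eval_neg_one_unitaryCyclotomic_mul_odd_prime_pow hm hp hodd hb hcop ?_
    obtain ⟨i1, -, i3, i4⟩ := ih m hlt hm
    by_cases hm1 : m = 1
    · rw [i1 hm1]
      norm_num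
    · by_cases hm3 : ∃ r a c : ℕ, r.Prime ∧ Odd r ∧ 1 ≤ a ∧ 1 ≤ c ∧ m = 2 ^ a * r ^ c
      · obtain ⟨r, a, c, hr, hro, ha, hc, hmr⟩ := hm3
        rw [i3 r a c hr hro ha hc hmr]
        exact pow_ne_zero _ (Nat.cast_ne_zero.2 hr.ne_zero)
      · rw [i4 hm1 (fun a ha hma => h3 p a b hp hodd ha (by omega) (by rw [hma]))
          (fun r a c hr hro ha hc hmr => hm3 ⟨r, a, c, hr, hro, ha, hc, hmr⟩)]
        exact one_ne_zero
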